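/- arXiv:1210.0117 — 2 statements merged into one kernel-verified Lean document; each statement's English description precedes it below -/
import Mathlib

section
/- (a) Every tropically convex set C ⊆ ℝ≥0^n is the intersection of the complements of sectors containing it: C = ⋂{ℝ≥0^n \ S_i(y) : y ∈ ℝ≥0^n \ C, i ∈ supp(y) ∪ {n+1}, C ⊆ ℝ≥0^n \ S_i(y)}, where the intersection of the empty family is ℝ≥0^n. (b) Every set F ⊆ ℝ≥0^n whose complement ℝ≥0^n \ F is tropically convex satisfies F = ⋃{S_i(y) : y ∈ F, i ∈ supp(y) ∪ {n+1}, S_i(y) ⊆ F}. -/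
open scoped NNReal

/-- A set in `ℝ≥0^n` is tropically convex (max-times model). -/
def TropConvex {n : ℕ} (C : Set (Fin n → ℝ≥0)) : Prop :=
  ∀ x ∈ C, ∀ y ∈ C, ∀ α β : ℝ≥0, max α β = 1 →
    (fun i => max (α * x i) (β * y i)) ∈ C

/-- A tropical cone: a nonempty set closed under coordinatewise max and scalar multiplication. -/
def TropCone {n : ℕ} (V : Set (Fin n → ℝ≥0)) : Prop :=
  V.Nonempty ∧ (∀ x ∈ V, ∀ y ∈ V, (fun i => max (x i) (y i)) ∈ V) ∧
    ∀ x ∈ V, ∀ lam : ℝ≥0, (fun i => lam * x i) ∈ V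

/-- Support of a vector. -/
def supp {n : ℕ} (x : Fin n → ℝ≥0) : Set (Fin n) := {i | x i ≠ 0}

/-- Quasisector of type `i` at `y`. -/
def quasiSector {n : ℕ} (y : Fin n → ℝ≥0) (i : Fin n) : Set (Fin n → ℝ≥0) :=
  {x | (∀ j ∈ supp y, x j * y i ≤ x i * y j) ∧ ∀ j ∉ supp y, x j = 0}


/-- Sector of type `i ∈ supp y` at `y`. -/
def sector {n : ℕ} (y : Fin n → ℝ≥0) (i : Fin n) : Set (Fin n → ℝ≥0) :=
  {x | (∀ j ∈ supp y, x j * y i ≤ x i * y j) ∧ y i ≤ x i ∧ ∀ j ∉ supp y, x j = 0}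

/-- Sector of type `n+1` at `y`. -/
def sectorTop {n : ℕ} (y : Fin n → ℝ≥0) : Set (Fin n → ℝ≥0) :=
  {x | ∀ j, x j ≤ y j}

theorem TropConvex.exists_le_eqOn {n : ℕ} {C : Set (Fin n → ℝ≥0)} (hC : TropConvex C)
    {y : Fin n → ℝ≥0} (htop : (C ∩ sectorTop y).Nonempty)
    (hsec : ∀ i ∈ supp y, (C ∩ sector y i).Nonempty) (s : Finset (Fin n)) :
    ∃ z ∈ C, z ≤ y ∧ ∀ i ∈ s, z i = y i := by
  induction s using Finset.induction_on with
  | empty =>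
    obtain ⟨z, hzC, hz⟩ := htop
    exact ⟨z, hzC, hz, by simp⟩
  | insert i s _ ih =>
    obtain ⟨z, hzC, hzy, hzs⟩ := ih
    by_cases hi : i ∈ supp y
    · obtain ⟨c, hcC, hcj, hci, hc0⟩ := hsec i hi
      have hpos : 0 < c i := (pos_iff_ne_zero.mpr hi).trans_le hci
      have hle : ∀ j, y i / c i * c j ≤ y j := fun j => by
        by_cases hj : j ∈ supp y
        · rw [div_mul_eq_mul_div, div_le_iff₀ hpos, mul_comm (y i), mul_comm (y j)]
          exact hcj j hj
        · simp [hc0 j hj]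
      have heq : y i / c i * c i = y i := div_mul_cancel₀ _ hpos.ne'
      refine ⟨_, hC z hzC c hcC 1 (y i / c i) (max_eq_left (div_le_one_of_le₀ hci zero_le)),
        fun j => max_le (by simpa using hzy j) (hle j), fun j hj => ?_⟩
      rcases Finset.mem_insert.mp hj with rfl | hj
      · simpa [heq] using hzy j
      · simpa [hzs j hj] using hle j
    · refine ⟨z, hzC, hzy, fun j hj => ?_⟩
      rcases Finset.mem_insert.mp hj with rfl | hj
      · have h0 : y j = 0 := not_not.mp hi
        rw [h0]
        exact le_antisymm (h0 ▸ hzy j) zero_le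
      · exact hzs j hj

/-- A point outside a tropically convex set is the apex of a sector disjoint from it. -/
theorem TropConvex.exists_sector_disjoint {n : ℕ} {C : Set (Fin n → ℝ≥0)} (hC : TropConvex C)
    {y : Fin n → ℝ≥0} (hy : y ∉ C) :
    ∃ S : Set (Fin n → ℝ≥0), ((∃ i ∈ supp y, S = sector y i) ∨ S = sectorTop y) ∧
      y ∈ S ∧ Disjoint C S := by
  by_contra! h
  have htop : (C ∩ sectorTop y).Nonempty :=
    Set.not_disjoint_iff_nonempty_inter.mp (h _ (.inr rfl) fun _ => le_rfl)
  have hsec : ∀ i ∈ supp y, (C ∩ sector y i).Nonempty := fun i hi =>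
    Set.not_disjoint_iff_nonempty_inter.mp <| h _ (.inl ⟨i, hi, rfl⟩)
      ⟨fun j _ => (mul_comm _ _).le, le_rfl, fun _ hj => not_not.mp hj⟩
  obtain ⟨z, hzC, -, hz⟩ := hC.exists_le_eqOn htop hsec Finset.univ
  exact hy (funext (fun i => hz i (Finset.mem_univ i)) ▸ hzC)

theorem stmt6 (n : ℕ) :
    (∀ C : Set (Fin n → ℝ≥0), TropConvex C →
      C = ⋂₀ {S : Set (Fin n → ℝ≥0) | ∃ y, y ∉ C ∧
            ((∃ i ∈ supp y, S = (sector y i)ᶜ) ∨ S = (sectorTop y)ᶜ) ∧ C ⊆ S}) ∧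
    (∀ F : Set (Fin n → ℝ≥0), TropConvex Fᶜ →
      F = ⋃₀ {S : Set (Fin n → ℝ≥0) | ∃ y ∈ F,
            ((∃ i ∈ supp y, S = sector y i) ∨ S = sectorTop y) ∧ S ⊆ F}) := by
  refine ⟨fun C hC => ?_, fun F hF => ?_⟩
  · refine Set.Subset.antisymm (Set.subset_sInter fun S ⟨_, _, _, hS⟩ => hS) fun x hx => ?_
    by_contra hxC
    obtain ⟨S, hS, hxS, hd⟩ := hC.exists_sector_disjoint hxC
    refine hx Sᶜ ⟨x, hxC, ?_, hd.subset_compl_right⟩ hxS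
    exact hS.imp (fun ⟨i, hi, h⟩ => ⟨i, hi, congrArg _ h⟩) (congrArg _)
  · refine Set.Subset.antisymm (fun x hx => ?_) (Set.sUnion_subset fun S ⟨_, _, _, hS⟩ => hS)
    obtain ⟨S, hS, hxS, hd⟩ := hF.exists_sector_disjoint (not_not.mpr hx)
    exact ⟨S, ⟨x, hx, hS, Set.disjoint_compl_left_iff_subset.mp hd⟩, hxS⟩
end

section
/- Every conical hemispace V ⊆ ℝ≥0^n satisfies V = cone(R), where R := {e^i ⊕ (y_j·y_i⁻¹)·e^j : y ∈ ℝ≥0^n, y ≠ 0, i ∈ supp(y), j ∈ supp(y), W_i(y) ⊆ V} and e^i ⊕ (y_j·y_i⁻¹)·e^j denotes the vector with i-th coordinate 1, j-th coordinate y_j/y_i, and all other coordinates 0. -/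
open scoped NNReal

/-- The `i`-th unit vector. -/
def unitVec {n : ℕ} (i : Fin n) : Fin n → ℝ≥0 := fun k => if k = i then 1 else 0

/-- The vector `e^i ⊕ λ e^j` (i-th coordinate `max 1 (λ·[i=j])`, j-th coordinate `λ`). -/
def duet {n : ℕ} (i j : Fin n) (lam : ℝ≥0) : Fin n → ℝ≥0 :=
  fun k => max (unitVec i k) (lam * unitVec j k)

/-- Tropical linear span (cone generated by `R`): all finite tropical linear combinations. -/
def tropSpan {n : ℕ} (R : Set (Fin n → ℝ≥0)) : Set (Fin n → ℝ≥0) :=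
  {x | ∃ (m : ℕ) (r : Fin m → Fin n → ℝ≥0) (l : Fin m → ℝ≥0),
    (∀ k, r k ∈ R) ∧ x = fun i => Finset.univ.sup fun k => l k * r k i}

/-- Tropical convex hull: all finite tropical convex combinations. -/
def tropConv {n : ℕ} (P : Set (Fin n → ℝ≥0)) : Set (Fin n → ℝ≥0) :=
  {x | ∃ (m : ℕ) (p : Fin m → Fin n → ℝ≥0) (l : Fin m → ℝ≥0),
    (∀ k, p k ∈ P) ∧ Finset.univ.sup l = 1 ∧
    x = fun i => Finset.univ.sup fun k => l k * p k i}

/-- Tropical Minkowski sum of two sets. -/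
def tropMink {n : ℕ} (A B : Set (Fin n → ℝ≥0)) : Set (Fin n → ℝ≥0) :=
  {z | ∃ a ∈ A, ∃ b ∈ B, z = fun i => max (a i) (b i)}

/-- A conical hemispace: a tropical cone whose complement, enlarged with `0`, is also a
tropical cone. -/
def IsConicalHemispace {n : ℕ} (V : Set (Fin n → ℝ≥0)) : Prop :=
  TropCone V ∧ ∃ V2 : Set (Fin n → ℝ≥0), TropCone V2 ∧ V ∩ V2 = {0} ∧ V ∪ V2 = Set.univ

theorem TropCone.zero_mem {n : ℕ} {V : Set (Fin n → ℝ≥0)} (hV : TropCone V) :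
    (0 : Fin n → ℝ≥0) ∈ V := by
  obtain ⟨⟨x, hx⟩, -, hsmul⟩ := hV
  have h := hsmul x hx 0
  simp only [zero_mul] at h
  exact h

theorem TropCone.finset_sup_mem {n : ℕ} {V : Set (Fin n → ℝ≥0)} (hV : TropCone V)
    {ι : Type*} (s : Finset ι) (f : ι → Fin n → ℝ≥0) (hf : ∀ k ∈ s, f k ∈ V) :
    (fun i => s.sup fun k => f k i) ∈ V := by
  classical
  induction s using Finset.induction_on with
  | empty => exact hV.zero_mem
  | insert a s _ ih =>
    have h := hV.2.1 _ (hf a (Finset.mem_insert_self a s)) _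
      (ih fun k hk => hf k (Finset.mem_insert_of_mem hk))
    simpa only [Finset.sup_insert] using h

theorem TropCone.tropSpan_subset {n : ℕ} {V R : Set (Fin n → ℝ≥0)} (hV : TropCone V)
    (hR : R ⊆ V) : tropSpan R ⊆ V := by
  rintro x ⟨m, r, l, hr, rfl⟩
  exact hV.finset_sup_mem Finset.univ (fun k i => l k * r k i)
    fun k _ => hV.2.2 _ (hR (hr k)) _

theorem duet_mem_quasiSector {n : ℕ} {y : Fin n → ℝ≥0} {i j : Fin n}
    (hi : i ∈ supp y) (hj : j ∈ supp y) : duet i j (y j * (y i)⁻¹) ∈ quasiSector y i := by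
  have hyi : y i ≠ 0 := hi
  have hone : 1 ≤ duet i j (y j * (y i)⁻¹) i := by simp [duet, unitVec]
  refine ⟨fun k _ => ?_, fun k hk => ?_⟩
  · refine le_trans ?_ (le_mul_of_one_le_left (zero_le) hone)
    rw [duet, max_mul]
    refine max_le ?_ ?_
    · by_cases h : k = i <;> simp [unitVec, h]
    · by_cases h : k = j
      · simp [unitVec, h, hyi]
      · simp [unitVec, h]
  · have hki : k ≠ i := fun h => hk (h ▸ hi)
    have hkj : k ≠ j := fun h => hk (h ▸ hj)
    simp [duet, unitVec, hki, hkj]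

/-- Rescaling a nonzero point of `quasiSector y i` gives a point below `y` that agrees with `y`
in coordinate `i`. -/
theorem TropCone.exists_le_of_mem_quasiSector {n : ℕ} {V : Set (Fin n → ℝ≥0)} (hV : TropCone V)
    {y z : Fin n → ℝ≥0} {i : Fin n} (hi : i ∈ supp y) (hz : z ∈ quasiSector y i) (hzV : z ∈ V)
    (hz0 : z ≠ 0) : ∃ w ∈ V, w i = y i ∧ ∀ j, w j ≤ y j := by
  have hyi : y i ≠ 0 := hi
  have hzi : z i ≠ 0 := by
    intro h
    refine hz0 (funext fun j => ?_)
    by_cases hj : j ∈ supp y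
    · have := hz.1 j hj
      rw [h, zero_mul, nonpos_iff_eq_zero] at this
      exact (mul_eq_zero.mp this).resolve_right hyi
    · exact hz.2 j hj
  refine ⟨_, hV.2.2 z hzV (y i * (z i)⁻¹), by field_simp, fun j => ?_⟩
  by_cases hj : j ∈ supp y
  · calc y i * (z i)⁻¹ * z j = (z i)⁻¹ * (z j * y i) := by ring
      _ ≤ (z i)⁻¹ * (z i * y j) := mul_le_mul_right (hz.1 j hj) _
      _ = y j := by field_simp
  · simp [hz.2 j hj]

theorem IsConicalHemispace.exists_quasiSector_subset {n : ℕ} {V : Set (Fin n → ℝ≥0)}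
    (hV : IsConicalHemispace V) {y : Fin n → ℝ≥0} (hy : y ∈ V) (hy0 : y ≠ 0) :
    ∃ i ∈ supp y, quasiSector y i ⊆ V := by
  obtain ⟨hV1, V2, hV2, hinter, hunion⟩ := hV
  by_contra! hcon
  have hw : ∀ i, ∃ w ∈ V2, w i = y i ∧ ∀ j, w j ≤ y j := by
    intro i
    by_cases hi : i ∈ supp y
    · obtain ⟨z, hz, hzV⟩ := Set.not_subset.mp (hcon i hi)
      have hzu : z ∈ V ∪ V2 := hunion ▸ Set.mem_univ z
      exact hV2.exists_le_of_mem_quasiSector hi hz (hzu.resolve_left hzV)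
        fun h => hzV (h ▸ hV1.zero_mem)
    · have hyi : y i = 0 := not_not.mp hi
      exact ⟨0, hV2.zero_mem, hyi.symm, fun j => zero_le⟩
  choose w hwV hwi hwle using hw
  have hsup : (fun j => Finset.univ.sup fun k => w k j) = y := by
    funext j
    refine le_antisymm (Finset.sup_le fun k _ => hwle k j) ?_
    rw [← hwi j]
    exact Finset.le_sup (f := fun k => w k j) (Finset.mem_univ j)
  have hyV2 : y ∈ V2 := hsup ▸ hV2.finset_sup_mem Finset.univ w fun k _ => hwV k
  exact hy0 (hinter.subset ⟨hy, hyV2⟩)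

theorem mul_duet_le {n : ℕ} {y : Fin n → ℝ≥0} {i : Fin n} (hi : y i ≠ 0) (j p : Fin n) :
    y i * duet i j (y j * (y i)⁻¹) p ≤ y p := by
  rw [duet, mul_max]
  refine max_le ?_ ?_
  · by_cases h : p = i <;> simp [unitVec, h]
  · by_cases h : p = j
    · subst h
      simp [unitVec, mul_comm (y p), hi]
    · simp [unitVec, h]

theorem le_mul_duet {n : ℕ} {y : Fin n → ℝ≥0} {i : Fin n} (hi : y i ≠ 0) (j : Fin n) :
    y j ≤ y i * duet i j (y j * (y i)⁻¹) j := by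
  rw [duet, mul_max]
  refine le_max_of_le_right ?_
  simp [unitVec, mul_comm (y j), hi]

theorem stmt11 {n : ℕ} (V : Set (Fin n → ℝ≥0)) (hV : IsConicalHemispace V) :
    V = tropSpan {v | ∃ y : Fin n → ℝ≥0, y ≠ 0 ∧ ∃ i ∈ supp y, ∃ j ∈ supp y,
          quasiSector y i ⊆ V ∧ v = duet i j (y j * (y i)⁻¹)} := by
  refine Set.Subset.antisymm (fun y hy => ?_) (hV.1.tropSpan_subset ?_)
  · by_cases hy0 : y = 0
    · exact ⟨0, Fin.elim0, Fin.elim0, fun k => k.elim0, by rw [hy0]; rfl⟩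
    obtain ⟨i, hi, hsub⟩ := hV.exists_quasiSector_subset hy hy0
    classical
    set g : Fin n → Fin n := fun k => if k ∈ supp y then k else i with hg
    have hgs : ∀ k, g k ∈ supp y := by
      intro k
      by_cases hk : k ∈ supp y
      · simp [hg, hk]
      · simpa [hg, hk] using hi
    refine ⟨n, fun k => duet i (g k) (y (g k) * (y i)⁻¹), fun _ => y i,
      fun k => ⟨y, hy0, i, hi, g k, hgs k, hsub, rfl⟩, funext fun p => ?_⟩
    refine le_antisymm ?_ (Finset.sup_le fun k _ => mul_duet_le hi (g k) p)
    by_cases hp : p ∈ supp y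
    · refine le_trans ?_ (Finset.le_sup (Finset.mem_univ p))
      have hgp : g p = p := if_pos hp
      simp only [hgp]
      exact le_mul_duet hi p
    · rw [show y p = 0 from not_not.mp hp]
      exact zero_le
  · rintro v ⟨y, -, i, hi, j, hj, hsub, rfl⟩
    exact hsub (duet_mem_quasiSector hi hj)
end
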